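/- Let d ≥ 2 and W : ℝ^d → [0,∞) continuous, and assume (H1) and (H2) hold for some a ∈ ℝ. Then for all δ > 0 there exists ε > 0 such that for all x, y ∈ ℝ^d_a with |x−y| ≥ δ one has c_W(x,y) ≥ ε. -/

import Mathlib

open MeasureTheory Filter Topology ENNReal

noncomputable section

/-- Squared Euclidean norm on `ℝ^d` (modelled as `Fin d → ℝ`). -/
def vnorm2 {d : ℕ} (v : Fin d → ℝ) : ℝ := ∑ i, v i ^ 2

/-- Partial derivative in the `i`-th coordinate direction of a map `ℝ^d → ℝ^d`. -/
def pd {d : ℕ} (i : Fin d) (u : (Fin d → ℝ) → Fin d → ℝ) (x : Fin d → ℝ) : Fin d → ℝ :=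
  fderiv ℝ u x (Pi.single i 1)

/-- Partial derivative in the `i`-th coordinate direction of a scalar function on `ℝ^d`. -/
def pdS {d : ℕ} (i : Fin d) (w : (Fin d → ℝ) → ℝ) (x : Fin d → ℝ) : ℝ :=
  fderiv ℝ w x (Pi.single i 1)

/-- Squared Frobenius norm `|∇u|²` of the Jacobian of `u`. -/
def gradSq {d : ℕ} (u : (Fin d → ℝ) → Fin d → ℝ) (x : Fin d → ℝ) : ℝ :=
  ∑ i, ∑ j, (pd i u x j) ^ 2

/-- Divergence-free condition `∇ ⋅ u = 0`. -/
def IsDivFree {d : ℕ} (u : (Fin d → ℝ) → Fin d → ℝ) : Prop :=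
  ∀ x, ∑ i, pd i u x i = 0

/-- Periodicity (period 1) in the last `d-1` coordinates: `u` is a map on `Ω = ℝ × 𝕋^{d-1}`. -/
def IsPeriodic {d : ℕ} [NeZero d] (u : (Fin d → ℝ) → Fin d → ℝ) : Prop :=
  ∀ (x : Fin d → ℝ) (i : Fin d), i ≠ 0 → u (x + Pi.single i 1) = u x

/-- Fundamental domain `ℝ × [0,1)^{d-1}` of `Ω = ℝ × 𝕋^{d-1}`. -/
def strip (d : ℕ) [NeZero d] : Set (Fin d → ℝ) :=
  {x | ∀ i : Fin d, i ≠ 0 → x i ∈ Set.Ico (0 : ℝ) 1}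

/-- The unit cube `[0,1)^d`. -/
def cube (d : ℕ) : Set (Fin d → ℝ) := Set.univ.pi fun _ => Set.Ico (0 : ℝ) 1

/-- The `x'`-average `ū(t) = ∫_{𝕋^{d-1}} u(t,x') dx'`. -/
def avg {d : ℕ} [NeZero d] (u : (Fin d → ℝ) → Fin d → ℝ) (t : ℝ) : Fin d → ℝ :=
  ∫ y in cube d, u (Function.update y 0 t)

/-- Energy density `½|∇u|² + W(u)`. -/
def eden {d : ℕ} (W : (Fin d → ℝ) → ℝ) (u : (Fin d → ℝ) → Fin d → ℝ) (x : Fin d → ℝ) : ℝ :=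
  (1 / 2) * gradSq u x + W (u x)

/-- Total energy `E(u)` on `Ω`, with values in `[0,∞]`. -/
def energy (d : ℕ) [NeZero d] (W : (Fin d → ℝ) → ℝ) (u : (Fin d → ℝ) → Fin d → ℝ) : ℝ≥0∞ :=
  ∫⁻ x in strip d, ENNReal.ofReal (eden W u x)

/-- Membership in `Ḣ¹_div(Ω, ℝ^d)` (with classical derivatives). -/
def Adm (d : ℕ) [NeZero d] (u : (Fin d → ℝ) → Fin d → ℝ) : Prop :=
  Differentiable ℝ u ∧ IsPeriodic u ∧ IsDivFree u ∧ IntegrableOn (gradSq u) (strip d)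

/-- The boundary conditions `ū(-∞) = u⁻`, `ū(+∞) = u⁺`. -/
def BdryCond (d : ℕ) [NeZero d] (u : (Fin d → ℝ) → Fin d → ℝ) (um up : Fin d → ℝ) : Prop :=
  Tendsto (avg u) atBot (𝓝 um) ∧ Tendsto (avg u) atTop (𝓝 up)

/-- `S_a`: the zeros of `W` in the hyperplane `{z₁ = a}`. -/
def wellSet (d : ℕ) [NeZero d] (W : (Fin d → ℝ) → ℝ) (a : ℝ) : Set (Fin d → ℝ) :=
  {z | z 0 = a ∧ W z = 0}

/-- Hypothesis (H2): `liminf_{z₁ → a, |z'| → ∞} W(z₁,z') > 0`. -/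
def H2cond (d : ℕ) [NeZero d] (W : (Fin d → ℝ) → ℝ) (a : ℝ) : Prop :=
  ∃ c > (0 : ℝ), ∃ δ > (0 : ℝ), ∃ R : ℝ, ∀ z : Fin d → ℝ,
    |z 0 - a| < δ → R ≤ ∑ i, (if i = (0 : Fin d) then 0 else z i ^ 2) → c ≤ W z

/-- The open interval with (possibly infinite) endpoints `tm`, `tp` (`none` codes `∓∞`). -/
def itv (tm tp : Option ℝ) : Set ℝ :=
  {t | (∀ s : ℝ, tm = some s → s < t) ∧ (∀ s : ℝ, tp = some s → t < s)}

/-- The transition cost `c_W(z⁻,z⁺)`: infimum of `E(u,I)` over intervals `I = (t⁻,t⁺)` and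
divergence-free maps `u` with `ū(t^±) = z^±`, where `t^± ∈ ℝ` if `W(z^±) > 0` and
`t^± = ±∞` if `W(z^±) = 0`. -/
def cW (d : ℕ) [NeZero d] (W : (Fin d → ℝ) → ℝ) (zm zp : Fin d → ℝ) : ℝ≥0∞ :=
  sInf {e | ∃ (u : (Fin d → ℝ) → Fin d → ℝ) (tm tp : Option ℝ),
    Differentiable ℝ u ∧ IsPeriodic u ∧ IsDivFree u ∧
    (W zm = 0 ↔ tm = none) ∧ (W zp = 0 ↔ tp = none) ∧
    (∀ s s' : ℝ, tm = some s → tp = some s' → s < s') ∧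
    (∀ s : ℝ, tm = some s → avg u s = zm) ∧
    (tm = none → Tendsto (avg u) atBot (𝓝 zm)) ∧
    (∀ s : ℝ, tp = some s → avg u s = zp) ∧
    (tp = none → Tendsto (avg u) atTop (𝓝 zp)) ∧
    e = ∫⁻ x in strip d ∩ {x | x 0 ∈ itv tm tp}, ENNReal.ofReal (eden W u x)}

/-- The pseudo-distance `d_W(v⁻,v⁺)`: infimum of `E(u,[t⁻,t⁺])` over compact intervals and
divergence-free maps `u` with traces `u(t^±,·) = v^±`. -/
def dW (d : ℕ) [NeZero d] (W : (Fin d → ℝ) → ℝ)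
    (vm vp : (Fin d → ℝ) → Fin d → ℝ) : ℝ≥0∞ :=
  sInf {e | ∃ (u : (Fin d → ℝ) → Fin d → ℝ) (tm tp : ℝ), tm ≤ tp ∧
    Differentiable ℝ u ∧ IsPeriodic u ∧ IsDivFree u ∧
    (∀ y, u (Function.update y 0 tm) = vm y) ∧
    (∀ y, u (Function.update y 0 tp) = vp y) ∧
    e = ∫⁻ x in strip d ∩ {x | x 0 ∈ Set.Icc tm tp}, ENNReal.ofReal (eden W u x)}

/-- Membership in `H¹_a(𝕋^{d-1}, ℝ^d)`: a map on the torus `𝕋^{d-1}` (modelled as a map on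
`ℝ^d` which is periodic and independent of the first variable) whose first component has
average `a`. -/
def MemH1a (d : ℕ) [NeZero d] (a : ℝ) (v : (Fin d → ℝ) → Fin d → ℝ) : Prop :=
  Differentiable ℝ v ∧ IsPeriodic v ∧
  (∀ (y : Fin d → ℝ) (t : ℝ), v (Function.update y 0 t) = v y) ∧
  (∫ y in cube d, v y 0) = a

/-- Strong `H¹(𝕋^{d-1})` convergence of a sequence of torus maps to `w`. -/
def H1Tendsto (d : ℕ) [NeZero d] (v : ℕ → (Fin d → ℝ) → Fin d → ℝ)
    (w : (Fin d → ℝ) → Fin d → ℝ) : Prop :=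
  Tendsto (fun n => ∫ y in cube d,
      (vnorm2 (v n y - w y) + gradSq (fun z => v n z - w z) y)) atTop (𝓝 0)

/-- Hypothesis (H4): lower semicontinuity of `d_W` on `S_a × S_a` with respect to strong `H¹`
convergence. -/
def H4cond (d : ℕ) [NeZero d] (W : (Fin d → ℝ) → ℝ) (a : ℝ) : Prop :=
  ∀ zm ∈ wellSet d W a, ∀ zp ∈ wellSet d W a,
    ∀ vm vp : ℕ → (Fin d → ℝ) → Fin d → ℝ,
      (∀ n, MemH1a d a (vm n)) → (∀ n, MemH1a d a (vp n)) →
      H1Tendsto d vm (fun _ => zm) → H1Tendsto d vp (fun _ => zp) →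
      dW d W (fun _ => zm) (fun _ => zp) ≤ liminf (fun n => dW d W (vm n) (vp n)) atTop

/-- Every interval of length `l` contains a subinterval, of length bounded below uniformly in the
position of the interval, which avoids a given finite set. -/
lemma exists_Ioo_disjoint_of_finite {F : Set ℝ} (hF : F.Finite) {l : ℝ} (hl : 0 < l) :
    ∃ κ > (0 : ℝ), ∀ A : ℝ, ∃ B, A ≤ B ∧ B + κ ≤ A + l ∧
      ∀ f ∈ F, f ∉ Set.Ioo B (B + κ) := by
  induction F, hF using Set.Finite.induction_on with
  | empty => exact ⟨l, hl, fun A => ⟨A, le_rfl, le_rfl, by simp⟩⟩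
  | @insert f s _ _ ih =>
    obtain ⟨κ, hκ, h⟩ := ih
    refine ⟨κ / 2, by positivity, fun A => ?_⟩
    obtain ⟨B, h1, h2, h3⟩ := h A
    rcases le_total f (B + κ / 2) with hf | hf
    · refine ⟨B + κ / 2, by linarith, by linarith, ?_⟩
      rintro g (rfl | hg) ⟨h4, h5⟩
      · linarith
      · exact h3 g hg ⟨by linarith, by linarith⟩
    · refine ⟨B, by linarith, by linarith, ?_⟩
      rintro g (rfl | hg) ⟨h4, h5⟩
      · linarith
      · exact h3 g hg ⟨by linarith, by linarith⟩

lemma exists_crossing_of_le {f : ℝ → ℝ} (hf : Continuous f) {t₀ t₁ p q : ℝ} (ht : t₀ ≤ t₁)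
    (hpq : p < q) (h0 : f t₀ ≤ p) (h1 : q ≤ f t₁) :
    ∃ s t, t₀ ≤ s ∧ s < t ∧ t ≤ t₁ ∧ q - p ≤ |f t - f s| ∧
      ∀ r ∈ Set.Ioo s t, f r ∈ Set.Icc p q := by
  have hc : IsCompact (Set.Icc t₀ t₁ ∩ f ⁻¹' Set.Ici q) :=
    isCompact_Icc.inter_right (isClosed_Ici.preimage hf)
  obtain ⟨t, ⟨⟨ht0, ht1⟩, hqt⟩, htmin⟩ := hc.exists_isLeast ⟨t₁, ⟨ht, le_rfl⟩, h1⟩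
  have hc' : IsCompact (Set.Icc t₀ t ∩ f ⁻¹' Set.Iic p) :=
    isCompact_Icc.inter_right (isClosed_Iic.preimage hf)
  obtain ⟨s, ⟨⟨hs0, hs1⟩, hps⟩, hsmax⟩ := hc'.exists_isGreatest ⟨t₀, ⟨le_rfl, ht0⟩, h0⟩
  simp only [Set.mem_preimage, Set.mem_Ici, Set.mem_Iic] at hqt hps
  refine ⟨s, t, hs0, ?_, ht1, ?_, ?_⟩
  · rcases hs1.lt_or_eq with h | rfl
    · exact h
    · linarith
  · rw [abs_of_nonneg] <;> linarith
  · rintro r ⟨hr1, hr2⟩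
    constructor
    · by_contra! h
      exact absurd (hsmax ⟨⟨by linarith, hr2.le⟩, h.le⟩) (not_le.2 hr1)
    · by_contra! h
      exact absurd (htmin ⟨⟨by linarith, by linarith⟩, h.le⟩) (not_le.2 hr2)

/-- A continuous function which moves by at least `l` crosses, on some interval, a band which
stays away from a given finite set. -/
lemma exists_crossing_far_from_finite {F : Set ℝ} (hF : F.Finite) {l : ℝ} (hl : 0 < l) :
    ∃ κ > (0 : ℝ), ∀ f : ℝ → ℝ, Continuous f → ∀ t₀ t₁, t₀ < t₁ → l ≤ |f t₁ - f t₀| →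
      ∃ s t, t₀ ≤ s ∧ s < t ∧ t ≤ t₁ ∧ κ ≤ |f t - f s| ∧
        ∀ r ∈ Set.Ioo s t, ∀ z ∈ F, κ ≤ |f r - z| := by
  obtain ⟨κ, hκ, h⟩ := exists_Ioo_disjoint_of_finite hF hl
  have key : ∀ B, (∀ z ∈ F, z ∉ Set.Ioo B (B + κ)) → ∀ x, x ∈ Set.Icc (B + κ / 3) (B + 2 * κ / 3) →
      ∀ z ∈ F, κ / 3 ≤ |x - z| := by
    intro B hB x hx z hz
    have h1 := hB z hz
    obtain ⟨h2, h3⟩ := hx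
    by_contra! h4
    rw [abs_lt] at h4
    exact h1 ⟨by linarith, by linarith⟩
  refine ⟨κ / 3, by positivity, fun f hf t₀ t₁ ht hfl => ?_⟩
  rcases le_total (f t₀) (f t₁) with hle | hle
  · rw [abs_of_nonneg (by linarith)] at hfl
    obtain ⟨B, h1, h2, h3⟩ := h (f t₀)
    obtain ⟨s, t, hs, hst, ht', h4, h5⟩ := exists_crossing_of_le hf ht.le
      (p := B + κ / 3) (q := B + 2 * κ / 3) (by linarith) (by linarith) (by linarith)
    exact ⟨s, t, hs, hst, ht', by linarith, fun r hr => key B h3 _ (h5 r hr)⟩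
  · rw [abs_of_nonpos (by linarith)] at hfl
    obtain ⟨B, h1, h2, h3⟩ := h (f t₁)
    obtain ⟨s, t, hs, hst, ht', h4, h5⟩ := exists_crossing_of_le hf.neg ht.le
      (p := -(B + 2 * κ / 3)) (q := -(B + κ / 3)) (by linarith)
      (by rw [Pi.neg_apply]; linarith) (by rw [Pi.neg_apply]; linarith)
    refine ⟨s, t, hs, hst, ht', ?_, fun r hr => key B h3 _ ?_⟩
    · have h6 : |f t - f s| = |(-f) t - (-f) s| := by
        rw [← abs_neg, Pi.neg_apply, Pi.neg_apply]
        congr 1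
        ring
      linarith
    · obtain ⟨h6, h7⟩ := h5 r hr
      rw [Pi.neg_apply] at h6 h7
      exact ⟨by linarith, by linarith⟩

/-- The increment of a differentiable curve is bounded by its length. -/
lemma enorm_sub_le_lintegral_deriv {E : Type*} [NormedAddCommGroup E] [NormedSpace ℝ E]
    [CompleteSpace E] [SecondCountableTopology E] [MeasurableSpace E] [BorelSpace E]
    {φ : ℝ → E} (hφ : Differentiable ℝ φ) {s t : ℝ} (hst : s ≤ t) :
    ‖φ t - φ s‖ₑ ≤ ∫⁻ r in Set.Ioo s t, ‖deriv φ r‖ₑ := by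
  rw [setLIntegral_congr Ioo_ae_eq_Ioc]
  by_cases htop : ∫⁻ r in Set.Ioc s t, ‖deriv φ r‖ₑ = ⊤
  · rw [htop]; exact le_top
  · have hint : IntervalIntegrable (deriv φ) volume s t := by
      rw [intervalIntegrable_iff_integrableOn_Ioc_of_le hst]
      exact ⟨(stronglyMeasurable_deriv φ).aestronglyMeasurable, lt_top_iff_ne_top.2 htop⟩
    rw [← intervalIntegral.integral_eq_sub_of_hasDerivAt
      (fun x _ => (hφ x).hasDerivAt) hint, intervalIntegral.integral_of_le hst]
    exact enorm_integral_le_lintegral_enorm _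

/-- Near the hyperplane `{z₁ = a}`, points of small potential are close to the wells. -/
lemma exists_near_wellSet {d : ℕ} [NeZero d] {W : (Fin d → ℝ) → ℝ} (hWc : Continuous W)
    (hWnn : ∀ z, 0 ≤ W z) {a : ℝ} (hH2 : H2cond d W a) {ρ : ℝ} (hρ : 0 < ρ) :
    ∃ σ > (0 : ℝ), ∀ z : Fin d → ℝ, |z 0 - a| ≤ σ → W z ≤ σ →
      ∃ w ∈ wellSet d W a, ‖z - w‖ < ρ := by
  obtain ⟨c, hc, δ, hδ, R, hR⟩ := hH2
  set K : Set (Fin d → ℝ) := {z | |z 0 - a| ≤ δ / 2 ∧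
    (∑ i, (if i = (0 : Fin d) then 0 else z i ^ 2) ≤ R) ∧ ∀ w ∈ wellSet d W a, ρ ≤ ‖z - w‖} with hK
  have hKc : IsCompact K := by
    apply Metric.isCompact_of_isClosed_isBounded
    · simp only [hK, Set.ofPred_and, Set.ofPred_forall]
      refine IsClosed.inter (isClosed_le (by fun_prop) (by fun_prop)) (IsClosed.inter
        (isClosed_le (continuous_finsetSum _ fun i _ => ?_) (by fun_prop))
        (isClosed_biInter fun w _ => isClosed_le (by fun_prop) (by fun_prop)))
      split_ifs <;> fun_prop
    · rw [isBounded_iff_forall_norm_le]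
      refine ⟨|a| + δ / 2 + R + 1, fun z hz => ?_⟩
      obtain ⟨h1, h2, -⟩ := hz
      have hR0 : 0 ≤ R := le_trans (Finset.sum_nonneg fun i _ => by split_ifs <;> positivity) h2
      rw [pi_norm_le_iff_of_nonneg (by positivity)]
      intro i
      rw [Real.norm_eq_abs]
      by_cases hi : i = 0
      · subst hi
        have := abs_sub_abs_le_abs_sub (z 0) a
        linarith
      · have h3 : z i ^ 2 ≤ R := by
          refine le_trans ?_ h2
          have := Finset.single_le_sum (f := fun i => if i = (0 : Fin d) then 0 else z i ^ 2)
            (fun i _ => by split_ifs <;> positivity) (Finset.mem_univ i)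
          simpa [hi] using this
        have h4 : |z i| ≤ z i ^ 2 + 1 := by
          rw [← sq_abs]; nlinarith [sq_nonneg (|z i| - 1), abs_nonneg (z i)]
        have := abs_nonneg a
        linarith
  obtain ⟨m, hm, hmK⟩ : ∃ m > (0 : ℝ), ∀ z ∈ K, m ≤ max |z 0 - a| (W z) := by
    have hcont : Continuous fun z : Fin d → ℝ => max |z 0 - a| (W z) := by fun_prop
    rcases K.eq_empty_or_nonempty with h | h
    · exact ⟨1, one_pos, by simp [h]⟩
    · obtain ⟨z, hz, hmin⟩ := hKc.exists_isMinOn h hcont.continuousOn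
      refine ⟨_, ?_, fun y hy => hmin hy⟩
      by_contra! hle
      have h1 : |z 0 - a| = 0 := le_antisymm ((le_max_left _ _).trans hle) (abs_nonneg _)
      have h2 : W z = 0 := le_antisymm ((le_max_right _ _).trans hle) (hWnn z)
      have := hz.2.2 z ⟨by rw [abs_eq_zero] at h1; linarith, h2⟩
      simp at this
      linarith
  refine ⟨min (m / 2) (min (c / 2) (δ / 2)), by positivity, fun z h1 h2 => ?_⟩
  have h3 := min_le_left (m / 2) (min (c / 2) (δ / 2))
  have h4 := (min_le_right (m / 2) (min (c / 2) (δ / 2))).trans (min_le_left _ _)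
  have h5 := (min_le_right (m / 2) (min (c / 2) (δ / 2))).trans (min_le_right _ _)
  by_contra! hfar
  have hzK : z ∈ K := by
    refine ⟨by linarith, ?_, hfar⟩
    by_contra! h6
    have := hR z (by linarith) h6.le
    linarith
  have := hmK z hzK
  rcases le_max_iff.1 this with h | h <;> linarith

/-- Lebesgue measure on the unit cube is a product of probability measures. -/
lemma restrict_cube_eq_pi (n : ℕ) :
    (volume : Measure (Fin n → ℝ)).restrict (cube n) =
      Measure.pi fun _ => (volume : Measure ℝ).restrict (Set.Ico 0 1) := by
  rw [cube, volume_pi, Measure.restrict_pi_pi]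

instance isProbabilityMeasure_restrict_Ico_zero_one :
    IsProbabilityMeasure ((volume : Measure ℝ).restrict (Set.Ico 0 1)) :=
  ⟨by simp⟩

instance isProbabilityMeasure_restrict_cube (n : ℕ) :
    IsProbabilityMeasure ((volume : Measure (Fin n → ℝ)).restrict (cube n)) := by
  rw [restrict_cube_eq_pi]; infer_instance

lemma restrict_cube_eq_restrict_Icc (n : ℕ) :
    (volume : Measure (Fin n → ℝ)).restrict (cube n) = volume.restrict (Set.Icc 0 1) := by
  rw [restrict_cube_eq_pi, ← Set.pi_univ_Icc, volume_pi, Measure.restrict_pi_pi]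
  congr 1
  ext1 i
  exact Measure.restrict_congr_set Ico_ae_eq_Icc

lemma lintegral_cube_succ {n : ℕ} {f : (Fin (n + 1) → ℝ) → ℝ≥0∞} (hf : Measurable f) :
    ∫⁻ p in cube (n + 1), f p =
      ∫⁻ a in Set.Ico (0 : ℝ) 1, ∫⁻ y in cube n, f (Fin.cons a y) := by
  rw [restrict_cube_eq_pi, restrict_cube_eq_pi]
  have h := (measurePreserving_piFinSuccAbove
    (fun _ : Fin (n + 1) => (volume : Measure ℝ).restrict (Set.Ico 0 1)) 0).symm
  rw [← h.lintegral_comp hf, lintegral_prod]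
  · refine lintegral_congr fun a => lintegral_congr fun y => ?_
    simp [MeasurableEquiv.piFinSuccAbove, Fin.insertNthEquiv]
  · exact (hf.comp (MeasurableEquiv.measurable _)).aemeasurable

/-- An `L¹` Poincaré inequality on the unit cube. -/
lemma lintegral_lintegral_edist_cube_le {E : Type*} [PseudoEMetricSpace E]
    [SecondCountableTopology E] {n : ℕ} {v : (Fin n → ℝ) → E} (hv : Continuous v)
    {g : Fin n → (Fin n → ℝ) → ℝ≥0∞} (hg : ∀ k, Measurable (g k))
    (hvg : ∀ k y, ∀ α ∈ Set.Ico (0 : ℝ) 1, ∀ β ∈ Set.Ico (0 : ℝ) 1,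
      edist (v (Function.update y k α)) (v (Function.update y k β)) ≤
        ∫⁻ r in Set.Ico (0 : ℝ) 1, g k (Function.update y k r)) :
    ∫⁻ p in cube n, ∫⁻ q in cube n, edist (v p) (v q) ≤ ∑ k, ∫⁻ p in cube n, g k p := by
  induction n with
  | zero =>
    have : ∀ p q, edist (v p) (v q) = 0 := fun p q => by
      rw [Subsingleton.elim p q, edist_self]
    simp [this]
  | succ n ih =>
    have hcons : Continuous fun p : ℝ × (Fin n → ℝ) => (Fin.cons p.1 p.2 : Fin (n + 1) → ℝ) :=
      Continuous.finCons continuous_fst continuous_snd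
    have hcons' : ∀ b : ℝ, Continuous fun y : Fin n → ℝ => (Fin.cons b y : Fin (n + 1) → ℝ) :=
      fun b => hcons.comp (by fun_prop : Continuous fun y : Fin n → ℝ => (b, y))
    set m := (volume : Measure ℝ).restrict (Set.Ico 0 1) with hm
    set μ := (volume : Measure (Fin n → ℝ)).restrict (cube n) with hμ
    have hin : ∀ b, ∫⁻ y, ∫⁻ z, edist (v (Fin.cons b y)) (v (Fin.cons b z)) ∂μ ∂μ ≤
        ∑ k : Fin n, ∫⁻ y, g k.succ (Fin.cons b y) ∂μ := by
      intro b
      refine ih (v := fun y => v (Fin.cons b y)) (hv.comp (hcons' b))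
        (fun k => (hg k.succ).comp (hcons' b).measurable) ?_
      intro k y α hα β hβ
      simp only [Fin.cons_update]
      exact hvg k.succ _ α hα β hβ
    have hout : ∀ y : Fin n → ℝ, ∀ α ∈ Set.Ico (0 : ℝ) 1, ∀ β ∈ Set.Ico (0 : ℝ) 1,
        edist (v (Fin.cons α y)) (v (Fin.cons β y)) ≤ ∫⁻ r, g 0 (Fin.cons r y) ∂m := by
      intro y α hα β hβ
      simpa only [Fin.update_cons_zero] using hvg 0 (Fin.cons 0 y) α hα β hβ
    have hme : Measurable fun p : (Fin (n + 1) → ℝ) × (Fin (n + 1) → ℝ) => edist (v p.1) (v p.2) :=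
      (by fun_prop : Continuous _).measurable
    have hg0 : Measurable fun y : Fin n → ℝ => ∫⁻ r, g 0 (Fin.cons r y) ∂m :=
      Measurable.lintegral_prod_left ((hg 0).comp hcons.measurable)
    have hgs : ∀ k, Measurable fun b : ℝ => ∫⁻ y, g k (Fin.cons b y) ∂μ := fun k =>
      Measurable.lintegral_prod_right ((hg k).comp hcons.measurable)
    have hgs' : ∀ k b, Measurable fun y : Fin n → ℝ => g k (Fin.cons b y) := fun k b =>
      (hg k).comp (hcons' b).measurable
    calc ∫⁻ p in cube (n + 1), ∫⁻ q in cube (n + 1), edist (v p) (v q)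
        = ∫⁻ α, ∫⁻ y, ∫⁻ b, ∫⁻ z, edist (v (Fin.cons α y)) (v (Fin.cons b z)) ∂μ ∂m ∂μ ∂m := by
          rw [lintegral_cube_succ (Measurable.lintegral_prod_right hme)]
          refine lintegral_congr fun α => lintegral_congr fun y => ?_
          exact lintegral_cube_succ (hme.comp measurable_prodMk_left)
      _ ≤ ∫⁻ α, ∫⁻ y, ∫⁻ b, ∫⁻ z, (∫⁻ r, g 0 (Fin.cons r y) ∂m +
            edist (v (Fin.cons b y)) (v (Fin.cons b z))) ∂μ ∂m ∂μ ∂m := by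
          refine setLIntegral_mono' measurableSet_Ico fun α hα => lintegral_mono fun y =>
            setLIntegral_mono' measurableSet_Ico fun b hb => lintegral_mono fun z => ?_
          exact (edist_triangle _ (v (Fin.cons b y)) _).trans (by gcongr; exact hout y α hα b hb)
      _ = ∫⁻ y, ∫⁻ r, g 0 (Fin.cons r y) ∂m ∂μ +
            ∫⁻ y, ∫⁻ b, ∫⁻ z, edist (v (Fin.cons b y)) (v (Fin.cons b z)) ∂μ ∂m ∂μ := by
          simp only [lintegral_add_left measurable_const, lintegral_const, measure_univ, mul_one]
          rw [lintegral_add_left hg0]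
      _ = ∫⁻ r, ∫⁻ y, g 0 (Fin.cons r y) ∂μ ∂m +
            ∫⁻ b, ∫⁻ y, ∫⁻ z, edist (v (Fin.cons b y)) (v (Fin.cons b z)) ∂μ ∂μ ∂m := by
          congr 1
          · exact (lintegral_lintegral_swap (f := fun r y => g 0 (Fin.cons r y))
              ((hg 0).comp hcons.measurable).aemeasurable).symm
          · refine lintegral_lintegral_swap (Measurable.aemeasurable ?_)
            refine Measurable.lintegral_prod_right' (f := fun (w : ((Fin n → ℝ) × ℝ) × (Fin n → ℝ)) =>
              edist (v (Fin.cons w.1.2 w.1.1)) (v (Fin.cons w.1.2 w.2))) ?_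
            refine Continuous.measurable (Continuous.edist (hv.comp ?_) (hv.comp ?_))
            · exact hcons.comp (by fun_prop : Continuous
                fun w : ((Fin n → ℝ) × ℝ) × (Fin n → ℝ) => (w.1.2, w.1.1))
            · exact hcons.comp (by fun_prop : Continuous
                fun w : ((Fin n → ℝ) × ℝ) × (Fin n → ℝ) => (w.1.2, w.2))
      _ ≤ ∫⁻ r, ∫⁻ y, g 0 (Fin.cons r y) ∂μ ∂m +
            ∫⁻ b, ∑ k : Fin n, ∫⁻ y, g k.succ (Fin.cons b y) ∂μ ∂m := by
          gcongr with b
          exact hin b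
      _ = ∑ k, ∫⁻ p in cube (n + 1), g k p := by
          rw [Fin.sum_univ_succ, lintegral_finsetSum _ fun k _ => hgs k.succ]
          simp only [lintegral_cube_succ (hg _), hm, hμ]

/-- Fubini's theorem on a slab of the strip. -/
lemma lintegral_strip_inter {d : ℕ} [NeZero d] {A : Set ℝ}
    {f : (Fin d → ℝ) → ℝ≥0∞} (hf : Measurable f) :
    ∫⁻ x in strip d ∩ {x | x 0 ∈ A}, f x =
      ∫⁻ r in A, ∫⁻ y in cube d, f (Function.update y 0 r) := by
  classical
  have hupd : Measurable fun p : ℝ × (Fin d → ℝ) => Function.update p.2 0 p.1 :=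
    (continuous_snd.update 0 continuous_fst).measurable
  have hset : strip d ∩ {x | x 0 ∈ A} =
      Set.univ.pi (Function.update (fun _ => Set.Ico (0 : ℝ) 1) 0 A) := by
    ext x
    simp only [strip, Set.mem_inter_iff, Set.mem_ofPred_eq, Set.mem_univ_pi]
    constructor
    · rintro ⟨h1, h2⟩ i
      by_cases hi : i = 0
      · subst hi; simpa using h2
      · simpa [hi] using h1 i hi
    · intro h
      exact ⟨fun i hi => by simpa [hi] using h i, by simpa using h 0⟩
  set ν : Fin d → Measure ℝ := fun i =>
    (volume : Measure ℝ).restrict (Function.update (fun _ => Set.Ico (0 : ℝ) 1) 0 A i) with hν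
  have hmap : Measure.pi ν = Measure.map (fun p : ℝ × (Fin d → ℝ) => Function.update p.2 0 p.1)
      (((volume : Measure ℝ).restrict A).prod (volume.restrict (cube d))) := by
    refine Measure.pi_eq fun s hs => ?_
    rw [Measure.map_apply hupd (MeasurableSet.univ_pi hs)]
    have : (fun p : ℝ × (Fin d → ℝ) => Function.update p.2 0 p.1) ⁻¹' Set.univ.pi s =
        s 0 ×ˢ Set.univ.pi (Function.update s 0 Set.univ) := by
      ext p
      simp only [Set.mem_preimage, Set.mem_univ_pi, Set.mem_prod]
      constructor
      · intro h
        refine ⟨by simpa using h 0, fun i => ?_⟩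
        by_cases hi : i = 0
        · subst hi; simp
        · simpa [hi] using h i
      · rintro ⟨h1, h2⟩ i
        by_cases hi : i = 0
        · subst hi; simpa using h1
        · simpa [hi] using h2 i
    rw [this, Measure.prod_prod, restrict_cube_eq_pi, Measure.pi_pi,
      ← Finset.mul_prod_erase Finset.univ (fun i => ν i (s i)) (Finset.mem_univ 0),
      ← Finset.mul_prod_erase Finset.univ _ (Finset.mem_univ (0 : Fin d))]
    simp only [hν, Function.update_self, measure_univ, one_mul]
    congr 1
    refine Finset.prod_congr rfl fun i hi => ?_
    simp [Finset.ne_of_mem_erase hi]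
  rw [hset, volume_pi, Measure.restrict_pi_pi]
  change ∫⁻ x, f x ∂Measure.pi ν = _
  rw [hmap, lintegral_map hf hupd]
  exact lintegral_prod _ (hf.comp hupd).aemeasurable

section Slices

variable {d : ℕ} {W : (Fin d → ℝ) → ℝ} {u : (Fin d → ℝ) → Fin d → ℝ}

lemma hasDerivAt_comp_update (hu : Differentiable ℝ u) (k : Fin d) (y : Fin d → ℝ) (r : ℝ) :
    HasDerivAt (fun r => u (Function.update y k r)) (pd k u (Function.update y k r)) r :=
  (hu _).hasFDerivAt.comp_hasDerivAt r (hasDerivAt_update y k r)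

lemma enorm_comp_update_sub_le (hu : Differentiable ℝ u) (k : Fin d) (y : Fin d → ℝ) {s t : ℝ}
    (hst : s ≤ t) :
    ‖u (Function.update y k t) - u (Function.update y k s)‖ₑ ≤
      ∫⁻ r in Set.Ioo s t, ‖pd k u (Function.update y k r)‖ₑ := by
  have h := enorm_sub_le_lintegral_deriv
    (fun r => (hasDerivAt_comp_update hu k y r).differentiableAt) hst
  simpa only [(hasDerivAt_comp_update hu k y _).deriv] using h

lemma measurable_pd (k : Fin d) : Measurable (pd k u) :=
  measurable_fderiv_apply_const ℝ u _

lemma measurable_eden (hWc : Continuous W) (hu : Continuous u) : Measurable (eden W u) := by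
  have h : Measurable (gradSq u) := by
    refine Finset.measurable_sum _ fun i _ => Finset.measurable_sum _ fun j _ => ?_
    exact ((measurable_pi_apply j).comp (measurable_pd i)).pow_const 2
  exact (h.const_mul _).add (hWc.comp hu).measurable

lemma gradSq_nonneg (x : Fin d → ℝ) : 0 ≤ gradSq u x :=
  Finset.sum_nonneg fun _ _ => Finset.sum_nonneg fun _ _ => sq_nonneg _

lemma norm_pd_le (hWnn : ∀ z, 0 ≤ W z) (k : Fin d) (x : Fin d → ℝ) {c : ℝ} (hc : 0 < c) :
    ‖pd k u x‖ ≤ c / 2 + c⁻¹ * eden W u x := by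
  have h0 : 0 ≤ eden W u x :=
    add_nonneg (mul_nonneg (by norm_num) (gradSq_nonneg x)) (hWnn _)
  rw [pi_norm_le_iff_of_nonneg (by positivity)]
  intro j
  rw [Real.norm_eq_abs]
  have h1 : (pd k u x j) ^ 2 ≤ gradSq u x :=
    (Finset.single_le_sum (f := fun j => (pd k u x j) ^ 2) (fun _ _ => sq_nonneg _)
      (Finset.mem_univ j)).trans
      (Finset.single_le_sum (f := fun i => ∑ j, (pd i u x j) ^ 2)
        (fun _ _ => Finset.sum_nonneg fun _ _ => sq_nonneg _) (Finset.mem_univ k))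
  have h2 : (pd k u x j) ^ 2 ≤ 2 * eden W u x := by
    have := hWnn (u x)
    unfold eden
    linarith
  have h3 : c * (c / 2 + c⁻¹ * eden W u x) = c ^ 2 / 2 + eden W u x := by
    field_simp
  refine le_of_mul_le_mul_left ?_ hc
  rw [h3]
  rw [← sq_abs] at h2
  nlinarith [sq_nonneg (c - |pd k u x j|)]

lemma enorm_pd_le (hWnn : ∀ z, 0 ≤ W z) (k : Fin d) (x : Fin d → ℝ) {c : ℝ} (hc : 0 < c) :
    ‖pd k u x‖ₑ ≤ ENNReal.ofReal (c / 2) + ENNReal.ofReal c⁻¹ * ENNReal.ofReal (eden W u x) := by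
  rw [← ENNReal.ofReal_mul (by positivity), ← ofReal_norm]
  exact (ENNReal.ofReal_le_ofReal (norm_pd_le hWnn k x hc)).trans ENNReal.ofReal_add_le

lemma continuous_comp_update [NeZero d] (hu : Continuous u) (t : ℝ) :
    Continuous fun y => u (Function.update y 0 t) :=
  hu.comp (continuous_id.update 0 continuous_const)

lemma integrable_comp_update [NeZero d] (hu : Continuous u) (t : ℝ) :
    IntegrableOn (fun y => u (Function.update y 0 t)) (cube d) := by
  rw [IntegrableOn, restrict_cube_eq_restrict_Icc]
  exact (continuous_comp_update hu t).continuousOn.integrableOn_compact isCompact_Icc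

lemma continuous_avg [NeZero d] (hu : Continuous u) : Continuous (avg u) := by
  unfold avg
  simp only [restrict_cube_eq_restrict_Icc]
  exact continuous_parametric_integral_of_continuous
    (f := fun t (y : Fin d → ℝ) => u (Function.update y 0 t))
    (hu.comp (continuous_snd.update 0 continuous_fst)) isCompact_Icc

/-- The energy of the slice `{x₁ = t}`. -/
def sliceEnergy [NeZero d] (W : (Fin d → ℝ) → ℝ) (u : (Fin d → ℝ) → Fin d → ℝ) (t : ℝ) : ℝ≥0∞ :=
  ∫⁻ y in cube d, ENNReal.ofReal (eden W u (Function.update y 0 t))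

lemma lintegral_enorm_pd_slice_le [NeZero d] (hWnn : ∀ z, 0 ≤ W z) (k : Fin d) (t : ℝ) {c : ℝ}
    (hc : 0 < c) :
    ∫⁻ y in cube d, ‖pd k u (Function.update y 0 t)‖ₑ ≤
      ENNReal.ofReal (c / 2) + ENNReal.ofReal c⁻¹ * sliceEnergy W u t := by
  refine (lintegral_mono fun y => enorm_pd_le hWnn k _ hc).trans_eq ?_
  rw [lintegral_add_left measurable_const, lintegral_const_mul' _ _ ENNReal.ofReal_ne_top]
  simp [sliceEnergy]

/-- Slices of small energy have some value of small potential which is close to the average. -/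
lemma exists_close_to_avg [NeZero d] (hWc : Continuous W) (hWnn : ∀ z, 0 ≤ W z) (hu : Differentiable ℝ u)
    {t c : ℝ} (hc : 0 < c) (hc1 : c ≤ 1) (he : sliceEnergy W u t ≤ ENNReal.ofReal (c ^ 2)) :
    ∃ z, ‖z - avg u t‖ ≤ (2 * d + 1) * c ∧ W z ≤ (2 * d + 1) * c := by
  set v : (Fin d → ℝ) → Fin d → ℝ := fun y => u (Function.update y 0 t) with hv
  have hvc : Continuous v := continuous_comp_update hu.continuous t
  have hpoinc : ∫⁻ p in cube d, ∫⁻ q in cube d, edist (v p) (v q) ≤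
      ∑ k : Fin d, ∫⁻ p in cube d, ‖pd k u (Function.update p 0 t)‖ₑ := by
    refine lintegral_lintegral_edist_cube_le hvc (g := fun k p => ‖pd k u (Function.update p 0 t)‖ₑ)
      (fun k => ((measurable_pd k).comp
        (continuous_id.update 0 continuous_const).measurable).enorm) ?_
    intro k y α hα β hβ
    by_cases hk : k = 0
    · subst hk
      simp [hv]
    · have key : ∀ α' ∈ Set.Ico (0 : ℝ) 1, ∀ β' ∈ Set.Ico (0 : ℝ) 1, α' ≤ β' →
          edist (v (Function.update y k β')) (v (Function.update y k α')) ≤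
            ∫⁻ r in Set.Ico (0 : ℝ) 1,
              ‖pd k u (Function.update (Function.update y k r) 0 t)‖ₑ := by
        intro α' hα' β' hβ' hle
        rw [edist_eq_enorm_sub]
        simp only [hv, Function.update_comm hk]
        refine (enorm_comp_update_sub_le hu k _ hle).trans (lintegral_mono_set ?_)
        exact fun r hr => ⟨hα'.1.trans hr.1.le, hr.2.trans hβ'.2⟩
      rcases le_total α β with h | h
      · rw [edist_comm]; exact key α hα β hβ h
      · exact key β hβ α hα h
  have htot : ∫⁻ p in cube d, (‖v p - avg u t‖ₑ + ENNReal.ofReal (W (v p))) ≤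
      ENNReal.ofReal ((2 * d + 1) * c) := by
    have hk : ∀ k : Fin d, ∫⁻ p in cube d, ‖pd k u (Function.update p 0 t)‖ₑ ≤
        ENNReal.ofReal (2 * c) := by
      intro k
      refine (lintegral_enorm_pd_slice_le hWnn k t hc).trans ?_
      refine (add_le_add_right (mul_le_mul_right he _) _).trans ?_
      rw [← ENNReal.ofReal_mul (by positivity), ← ENNReal.ofReal_add (by positivity) (by positivity)]
      refine ENNReal.ofReal_le_ofReal ?_
      have : c⁻¹ * c ^ 2 = c := by field_simp
      rw [this]; linarith
    have h1 : ∫⁻ p in cube d, ‖v p - avg u t‖ₑ ≤ ENNReal.ofReal (2 * d * c) := by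
      calc ∫⁻ p in cube d, ‖v p - avg u t‖ₑ
          ≤ ∫⁻ p in cube d, ∫⁻ q in cube d, edist (v p) (v q) := by
            refine lintegral_mono fun p => ?_
            have : v p - avg u t = ∫ q in cube d, (v p - v q) := by
              rw [integral_sub (integrable_const _) (integrable_comp_update hu.continuous t)]
              simp [avg, hv]
            rw [this]
            simp only [edist_eq_enorm_sub]
            exact enorm_integral_le_lintegral_enorm _
        _ ≤ ∑ k : Fin d, ENNReal.ofReal (2 * c) :=
            hpoinc.trans (Finset.sum_le_sum fun k _ => hk k)
        _ = ENNReal.ofReal (2 * d * c) := by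
            rw [Finset.sum_const, Finset.card_univ, Fintype.card_fin, nsmul_eq_mul,
              ← ENNReal.ofReal_natCast, ← ENNReal.ofReal_mul (by positivity)]
            congr 1; ring
    have h2 : ∫⁻ p in cube d, ENNReal.ofReal (W (v p)) ≤ ENNReal.ofReal c := by
      refine le_trans (lintegral_mono fun p => ENNReal.ofReal_le_ofReal ?_)
        (he.trans (ENNReal.ofReal_le_ofReal (by nlinarith)))
      have := gradSq_nonneg (u := u) (Function.update p 0 t)
      simp only [eden, hv]; linarith
    rw [lintegral_add_right _ (by fun_prop)]
    refine (add_le_add h1 h2).trans_eq ?_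
    rw [← ENNReal.ofReal_add (by positivity) (by positivity)]
    congr 1; ring
  obtain ⟨p, hp⟩ := exists_le_lintegral (μ := volume.restrict (cube d))
    (f := fun p => ‖v p - avg u t‖ₑ + ENNReal.ofReal (W (v p))) (by fun_prop)
  have hp' := hp.trans htot
  refine ⟨v p, ?_, ?_⟩
  · have := le_self_add.trans hp'
    rwa [← ofReal_norm, ENNReal.ofReal_le_ofReal_iff (by positivity)] at this
  · have := le_add_self.trans hp'
    rwa [ENNReal.ofReal_le_ofReal_iff (by positivity)] at this

/-- If the average of a slice is on the hyperplane `{z₁ = a}` and away from the wells, then the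
slice has at least a fixed amount of energy. -/
lemma exists_le_sliceEnergy [NeZero d] (hWc : Continuous W) (hWnn : ∀ z, 0 ≤ W z) {a : ℝ}
    (hH2 : H2cond d W a) {ρ : ℝ} (hρ : 0 < ρ) :
    ∃ η > (0 : ℝ), ∀ u : (Fin d → ℝ) → Fin d → ℝ, Differentiable ℝ u → ∀ t, avg u t 0 = a →
      (∀ w ∈ wellSet d W a, ρ ≤ ‖avg u t - w‖) → ENNReal.ofReal η ≤ sliceEnergy W u t := by
  obtain ⟨σ, hσ, hw⟩ := exists_near_wellSet hWc hWnn hH2 (half_pos hρ)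
  set τ := min σ (ρ / 2) with hτ
  have hτ0 : 0 < τ := by positivity
  set c := min 1 (τ / (2 * d + 1)) with hc
  have hc0 : 0 < c := by positivity
  refine ⟨c ^ 2, by positivity, fun u hu t ha hfar => ?_⟩
  by_contra! hlt
  obtain ⟨z, h1, h2⟩ := exists_close_to_avg hWc hWnn hu hc0 (min_le_left _ _) hlt.le
  have h3 : (2 * d + 1) * c ≤ τ := by
    have : c ≤ τ / (2 * d + 1) := min_le_right _ _
    rw [le_div_iff₀ (by positivity)] at this
    linarith
  have h4 : τ ≤ σ := min_le_left _ _
  have h5 : τ ≤ ρ / 2 := min_le_right _ _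
  have h6 : |z 0 - a| ≤ ‖z - avg u t‖ := by
    rw [← ha]
    exact norm_le_pi_norm (z - avg u t) 0
  obtain ⟨w, hwS, hwz⟩ := hw z (by linarith) (by linarith)
  have h7 := hfar w hwS
  have h8 := norm_sub_le_norm_sub_add_norm_sub (avg u t) z w
  rw [norm_sub_rev (avg u t) z] at h8
  linarith

lemma enorm_avg_sub_le [NeZero d] (hWnn : ∀ z, 0 ≤ W z) (hu : Differentiable ℝ u)
    {s t : ℝ} (hst : s ≤ t) :
    ‖avg u t - avg u s‖ₑ ≤ ∫⁻ r in Set.Ioo s t, (1 + sliceEnergy W u r) := by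
  have hm : Measurable fun p : (Fin d → ℝ) × ℝ => ‖pd 0 u (Function.update p.1 0 p.2)‖ₑ :=
    ((measurable_pd 0).comp (continuous_fst.update 0 continuous_snd).measurable).enorm
  calc ‖avg u t - avg u s‖ₑ
      = ‖∫ y in cube d, (u (Function.update y 0 t) - u (Function.update y 0 s))‖ₑ := by
        rw [integral_sub (integrable_comp_update hu.continuous t)
          (integrable_comp_update hu.continuous s)]
        rfl
    _ ≤ ∫⁻ y in cube d, ‖u (Function.update y 0 t) - u (Function.update y 0 s)‖ₑ :=
        enorm_integral_le_lintegral_enorm _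
    _ ≤ ∫⁻ y in cube d, ∫⁻ r in Set.Ioo s t, ‖pd 0 u (Function.update y 0 r)‖ₑ :=
        lintegral_mono fun y => enorm_comp_update_sub_le hu 0 y hst
    _ = ∫⁻ r in Set.Ioo s t, ∫⁻ y in cube d, ‖pd 0 u (Function.update y 0 r)‖ₑ :=
        lintegral_lintegral_swap (f := fun y r => ‖pd 0 u (Function.update y 0 r)‖ₑ)
          hm.aemeasurable
    _ ≤ ∫⁻ r in Set.Ioo s t, (1 + sliceEnergy W u r) := by
        refine lintegral_mono fun r => ?_
        refine (lintegral_enorm_pd_slice_le hWnn 0 r one_pos).trans ?_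
        rw [inv_one, ENNReal.ofReal_one, one_mul]
        gcongr
        exact (ENNReal.ofReal_le_ofReal (by norm_num)).trans_eq ENNReal.ofReal_one

end Slices

/-- The first component of the slice averages of a periodic divergence-free map is constant. -/
lemma avg_apply_zero_eq {d : ℕ} [NeZero d] {u : (Fin d → ℝ) → Fin d → ℝ}
    (hu : Differentiable ℝ u) (hper : IsPeriodic u) (hdiv : IsDivFree u) (s t : ℝ) :
    avg u s 0 = avg u t 0 := by
  wlog hst : s ≤ t generalizing s t
  · exact (this t s (le_of_not_ge hst)).symm
  obtain ⟨n, rfl⟩ := Nat.exists_eq_succ_of_ne_zero (NeZero.ne d)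
  have hface : ∀ r : ℝ, avg u r 0 = ∫ y in Set.Icc (0 : Fin n → ℝ) 1,
      u (Fin.insertNth 0 r y) 0 := by
    intro r
    have h1 : avg u r 0 = ∫ y in cube (n + 1), u (Function.update y 0 r) 0 :=
      eval_integral (fun i => (integrable_pi_iff.1 (integrable_comp_update hu.continuous r)) i) 0
    rw [h1, restrict_cube_eq_pi, ← restrict_cube_eq_restrict_Icc, restrict_cube_eq_pi]
    have hmp := measurePreserving_snd.comp (measurePreserving_piFinSuccAbove
      (fun _ : Fin (n + 1) => (volume : Measure ℝ).restrict (Set.Ico 0 1)) 0)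
    rw [← hmp.map_eq, integral_map hmp.measurable.aemeasurable]
    · refine integral_congr_ae (Eventually.of_forall fun y => ?_)
      dsimp only
      congr 2
      ext i
      refine Fin.cases ?_ (fun j => ?_) i <;>
        simp [MeasurableEquiv.piFinSuccAbove, Fin.insertNthEquiv, Fin.tail]
    · refine Continuous.aestronglyMeasurable ?_
      exact (continuous_apply 0).comp (hu.continuous.comp (continuous_const.finInsertNth 0 continuous_id))
  set p : Fin (n + 1) → ℝ := Fin.insertNth 0 s 0 with hp
  set q : Fin (n + 1) → ℝ := Fin.insertNth 0 t 1 with hq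
  have hpq : p ≤ q := by
    intro i
    refine Fin.cases ?_ (fun j => ?_) i <;> simp [hp, hq, hst]
  have hdiv' : ∀ x, ∑ i, fderiv ℝ u x (Pi.single i 1) i = 0 := hdiv
  have h := integral_divergence_of_hasFDerivAt_off_countable p q hpq u (fderiv ℝ u) ∅
    Set.countable_empty hu.continuous.continuousOn (fun x _ => (hu x).hasFDerivAt)
    (by simp [hdiv'])
  simp only [hdiv', integral_zero] at h
  rw [Fin.sum_univ_succ, Finset.sum_eq_zero, add_zero] at h
  · have hp' : p ∘ Fin.succAbove 0 = 0 := by ext j; simp [hp]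
    have hq' : q ∘ Fin.succAbove 0 = 1 := by ext j; simp [hq]
    have hp0 : p 0 = s := by simp [hp]
    have hq0 : q 0 = t := by simp [hq]
    rw [hp', hq', hp0, hq0] at h
    rw [hface, hface]
    linarith
  · intro i _
    rw [sub_eq_zero]
    refine integral_congr_ae (Eventually.of_forall fun y => ?_)
    have hpi : p i.succ = 0 := by simp [hp]
    have hqi : q i.succ = 1 := by simp [hq]
    have : (Fin.insertNth i.succ (1 : ℝ) y : Fin (n + 1) → ℝ) =
        Fin.insertNth i.succ (0 : ℝ) y + Pi.single i.succ 1 := by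
      ext j
      rcases Fin.eq_self_or_eq_succAbove i.succ j with rfl | ⟨j, rfl⟩ <;> simp
    dsimp only
    rw [hpi, hqi, this, hper _ i.succ (Fin.succ_ne_zero i)]

/-- A stretch on which the slices carry energy at least `η` and along which the average moves
by at least `κ` costs a fixed amount of energy. -/
lemma ofReal_le_lintegral_slab {d : ℕ} [NeZero d] {W : (Fin d → ℝ) → ℝ}
    {u : (Fin d → ℝ) → Fin d → ℝ} (hWc : Continuous W) (hWnn : ∀ z, 0 ≤ W z)
    (hu : Differentiable ℝ u) {s t η κ : ℝ} (hst : s ≤ t) (hη : 0 < η)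
    (he : ∀ r ∈ Set.Ioo s t, ENNReal.ofReal η ≤ sliceEnergy W u r)
    (hκ : κ ≤ ‖avg u t - avg u s‖) :
    ENNReal.ofReal (κ / (η⁻¹ + 1)) ≤
      ∫⁻ x in strip d ∩ {x | x 0 ∈ Set.Ioo s t}, ENNReal.ofReal (eden W u x) := by
  rw [lintegral_strip_inter (measurable_eden hWc hu.continuous).ennreal_ofReal,
    ENNReal.ofReal_div_of_pos (by positivity)]
  refine ENNReal.div_le_of_le_mul ?_
  calc ENNReal.ofReal κ ≤ ‖avg u t - avg u s‖ₑ := by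
        rw [← ofReal_norm]; exact ENNReal.ofReal_le_ofReal hκ
    _ ≤ ∫⁻ r in Set.Ioo s t, (1 + sliceEnergy W u r) := enorm_avg_sub_le hWnn hu hst
    _ ≤ ∫⁻ r in Set.Ioo s t, sliceEnergy W u r * ENNReal.ofReal (η⁻¹ + 1) := by
        refine setLIntegral_mono' measurableSet_Ioo fun r hr => ?_
        rw [ENNReal.ofReal_add (by positivity) zero_le_one, ENNReal.ofReal_one, mul_add, mul_one]
        gcongr
        calc (1 : ℝ≥0∞) = ENNReal.ofReal η * ENNReal.ofReal η⁻¹ := by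
              rw [← ENNReal.ofReal_mul hη.le, mul_inv_cancel₀ hη.ne', ENNReal.ofReal_one]
          _ ≤ _ := by gcongr; exact he r hr
    _ = _ := lintegral_mul_const' _ _ ENNReal.ofReal_ne_top

/-- The boundary conditions in the definition of the transition cost are approximately attained
at the ends of some bounded interval. -/
lemma exists_endpoints {E : Type*} [SeminormedAddCommGroup E] {f : ℝ → E} {zm zp : E}
    {tm tp : Option ℝ} (h : ∀ s s' : ℝ, tm = some s → tp = some s' → s < s')
    (hm : ∀ s : ℝ, tm = some s → f s = zm) (hm' : tm = none → Tendsto f atBot (𝓝 zm))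
    (hp : ∀ s : ℝ, tp = some s → f s = zp) (hp' : tp = none → Tendsto f atTop (𝓝 zp))
    {r : ℝ} (hr : 0 < r) :
    ∃ t₀ t₁, t₀ < t₁ ∧ Set.Ioo t₀ t₁ ⊆ itv tm tp ∧ ‖f t₀ - zm‖ < r ∧ ‖f t₁ - zp‖ < r := by
  have hbot : tm = none → ∀ᶠ t in atBot, ‖f t - zm‖ < r := fun h => by
    simpa only [dist_eq_norm] using Metric.tendsto_nhds.1 (hm' h) r hr
  have htop : tp = none → ∀ᶠ t in atTop, ‖f t - zp‖ < r := fun h => by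
    simpa only [dist_eq_norm] using Metric.tendsto_nhds.1 (hp' h) r hr
  rcases tm with _ | s <;> rcases tp with _ | s'
  · obtain ⟨t₁, h1⟩ := (htop rfl).exists
    obtain ⟨t₀, h0, hlt⟩ := ((hbot rfl).and (eventually_lt_atBot t₁)).exists
    exact ⟨t₀, t₁, hlt, fun t _ => ⟨by simp, by simp⟩, h0, h1⟩
  · obtain ⟨t₀, h0, hlt⟩ := ((hbot rfl).and (eventually_lt_atBot s')).exists
    exact ⟨t₀, s', hlt, fun t ht => ⟨by simp, by simpa using ht.2⟩, h0, by simpa [hp s' rfl]⟩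
  · obtain ⟨t₁, h1, hlt⟩ := ((htop rfl).and (eventually_gt_atTop s)).exists
    exact ⟨s, t₁, hlt, fun t ht => ⟨by simpa using ht.1, by simp⟩, by simpa [hm s rfl], h1⟩
  · exact ⟨s, s', h s s' rfl rfl, fun t ht => ⟨by simpa using ht.1, by simpa using ht.2⟩,
      by simpa [hm s rfl], by simpa [hp s' rfl]⟩

lemma exists_div_le_abs_of_le_sqrt_vnorm2 {d : ℕ} [NeZero d] {v : Fin d → ℝ} {δ : ℝ} (hδ : 0 < δ)
    (h : δ ≤ Real.sqrt (vnorm2 v)) : ∃ i, δ / d ≤ |v i| := by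
  by_contra! hlt
  have hd : (1 : ℝ) ≤ d := by exact_mod_cast NeZero.one_le
  have h1 : δ ^ 2 ≤ vnorm2 v := by
    rwa [Real.le_sqrt' hδ] at h
  have h2 : vnorm2 v < ∑ _i : Fin d, (δ / d) ^ 2 := by
    refine Finset.sum_lt_sum_of_nonempty Finset.univ_nonempty fun i _ => ?_
    rw [← sq_abs]
    exact pow_lt_pow_left₀ (hlt i) (abs_nonneg _) two_ne_zero
  have h3 : ∑ _i : Fin d, (δ / d) ^ 2 = δ ^ 2 / d := by
    rw [Finset.sum_const, Finset.card_univ, Fintype.card_fin, nsmul_eq_mul]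
    field_simp
  have h4 : δ ^ 2 / d ≤ δ ^ 2 := div_le_self (sq_nonneg δ) hd
  linarith

/-- Proposition `cdW`: under (H1) and (H2), the transition cost `c_W` is
nondegenerate: for all `δ > 0` there is `ε > 0` such that `|x-y| ≥ δ` implies
`c_W(x,y) ≥ ε` for `x, y` in the hyperplane `{z₁ = a}`. -/
theorem statement11 (d : ℕ) [NeZero d] (hd : 2 ≤ d)
    (W : (Fin d → ℝ) → ℝ) (hWc : Continuous W) (hWnn : ∀ z, 0 ≤ W z)
    (a : ℝ) (hH1 : (wellSet d W a).Finite) (hH2 : H2cond d W a) :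
    ∀ δ > (0 : ℝ), ∃ ε > (0 : ℝ), ∀ x y : Fin d → ℝ, x 0 = a → y 0 = a →
      δ ≤ Real.sqrt (vnorm2 (x - y)) → ENNReal.ofReal ε ≤ cW d W x y := by
  intro δ hδ
  have hd0 : (0 : ℝ) < d := by exact_mod_cast (by omega : 0 < d)
  have hF : (⋃ i : Fin d, (fun z : Fin d → ℝ => z i) '' wellSet d W a).Finite :=
    Set.finite_iUnion fun i => hH1.image _
  obtain ⟨κ, hκ, hcross⟩ := exists_crossing_far_from_finite hF (l := δ / d / 2) (by positivity)
  obtain ⟨η, hη, hslice⟩ := exists_le_sliceEnergy hWc hWnn hH2 hκ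
  refine ⟨κ / (η⁻¹ + 1), by positivity, fun x y hx hy hxy => le_sInf ?_⟩
  rintro e ⟨u, tm, tp, hu, hper, hdiv, -, -, hlt, hm, hm', hp, hp', rfl⟩
  obtain ⟨i, hi⟩ := exists_div_le_abs_of_le_sqrt_vnorm2 hδ hxy
  have hcont := continuous_avg hu.continuous
  have havg : ∀ t, avg u t 0 = a := by
    intro t
    rcases tm with _ | s
    · have h1 : Tendsto (fun s => avg u s 0) atBot (𝓝 (x 0)) :=
        ((continuous_apply 0).tendsto x).comp (hm' rfl)
      have h2 : (fun s => avg u s 0) = fun _ => avg u t 0 :=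
        funext fun s => avg_apply_zero_eq hu hper hdiv s t
      rw [h2] at h1
      exact (tendsto_nhds_unique tendsto_const_nhds h1).trans hx
    · rw [avg_apply_zero_eq hu hper hdiv t s, hm s rfl, hx]
  obtain ⟨t₀, t₁, ht, hsub, h0, h1⟩ :=
    exists_endpoints hlt hm hm' hp hp' (r := δ / d / 4) (by positivity)
  have h0i : |avg u t₀ i - x i| < δ / d / 4 := (norm_le_pi_norm (avg u t₀ - x) i).trans_lt h0
  have h1i : |avg u t₁ i - y i| < δ / d / 4 := (norm_le_pi_norm (avg u t₁ - y) i).trans_lt h1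
  have hmove : δ / d / 2 ≤ |avg u t₁ i - avg u t₀ i| := by
    have h2 : |x i - y i| ≤ |avg u t₁ i - avg u t₀ i| + |avg u t₀ i - x i| + |avg u t₁ i - y i| := by
      rw [abs_sub_comm (avg u t₁ i), abs_sub_comm (avg u t₀ i) (x i)]
      have h3 := abs_sub_le (x i) (avg u t₀ i) (y i)
      have h4 := abs_sub_le (avg u t₀ i) (avg u t₁ i) (y i)
      linarith
    rw [Pi.sub_apply] at hi
    linarith
  obtain ⟨s, t, hs, hst, ht', hjump, hfar⟩ :=
    hcross (fun t => avg u t i) ((continuous_apply i).comp hcont) t₀ t₁ ht hmove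
  refine (ofReal_le_lintegral_slab hWc hWnn hu hst.le hη (fun r hr => ?_)
    (hjump.trans (norm_le_pi_norm (avg u t - avg u s) i))).trans (lintegral_mono_set ?_)
  · refine hslice u hu r (havg r) fun w hw => ?_
    exact (hfar r hr (w i) (Set.mem_iUnion.2 ⟨i, w, hw, rfl⟩)).trans
      (norm_le_pi_norm (avg u r - w) i)
  · exact Set.inter_subset_inter_right _ fun z hz => hsub ⟨hs.trans_lt hz.1, hz.2.trans_le ht'⟩
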